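/- The logic L is sound and weakly complete with respect to expertise frames: for every formula φ of 𝓛, φ is a theorem of L if and only if φ is valid (true at every state of every expertise model). Here L is the smallest set of 𝓛-formulas containing all propositional tautologies and all instances of the axioms K_S: (Sφ ∧ ¬Sψ) → S(φ ∧ ¬ψ); T_S: φ → Sφ; 5_S: S¬Sφ → ¬Sφ; K_A: A(φ → ψ) → (Aφ → Aψ); T_A: Aφ → φ; 5_A: ¬Aφ → A¬Aφ; ES: Eφ ↔ A(Sφ → φ); Inc: Aφ → ¬S¬φ; and closed under the rules modus ponens (from φ and φ → ψ infer ψ), necessitation for A (from φ infer Aφ), and replacement for S (from φ ↔ ψ infer Sφ ↔ Sψ). -/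

import Mathlib

/-- The language 𝓛: propositional variables (indexed by ℕ, hence countable),
negation, conjunction, and modalities E (expertise), S (soundness), A (universal). -/
inductive Form : Type where
  | var : ℕ → Form
  | neg : Form → Form
  | and : Form → Form → Form
  | E : Form → Form
  | S : Form → Form
  | A : Form → Form

/-- Material implication, as the usual Boolean abbreviation. -/
def Form.imp (φ ψ : Form) : Form := .neg (.and φ (.neg ψ))

/-- Biconditional, as the usual Boolean abbreviation. -/
def Form.iff (φ ψ : Form) : Form := .and (φ.imp ψ) (ψ.imp φ)

/-- An expertise model on a set of states `X`: an expertise set `P`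
(containing `X`, closed under complements and arbitrary intersections)
together with a valuation `v`. -/
structure ExpModel (X : Type*) where
  P : Set (Set X)
  univ_mem : Set.univ ∈ P
  compl_mem : ∀ A ∈ P, Aᶜ ∈ P
  sInter_mem : ∀ Q ⊆ P, ⋂₀ Q ∈ P
  v : ℕ → Set X

/-- The truth set `‖φ‖_M` of a formula in an expertise model. -/
def truthSet {X : Type*} (M : ExpModel X) : Form → Set X
  | .var p => M.v p
  | .neg φ => (truthSet M φ)ᶜ
  | .and φ ψ => truthSet M φ ∩ truthSet M ψ
  | .E φ => {_x | truthSet M φ ∈ M.P}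
  | .S φ => {x | ∀ A ∈ M.P, truthSet M φ ⊆ A → x ∈ A}
  | .A φ => {_x | ∀ y, y ∈ truthSet M φ}

/-- Satisfaction: `M, x ⊨ φ`. -/
def Sat {X : Type*} (M : ExpModel X) (x : X) (φ : Form) : Prop :=
  x ∈ truthSet M φ

/-- Validity: `φ` is true at every state of every expertise model. -/
def Valid (φ : Form) : Prop :=
  ∀ (X : Type*) (M : ExpModel X) (x : X), Sat M x φ

/-- Purely propositional formulas, used to define propositional tautologies. -/
inductive PForm : Type where
  | var : ℕ → PForm
  | neg : PForm → PForm
  | and : PForm → PForm → PForm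

/-- Evaluation of a propositional formula under a truth assignment. -/
def PForm.eval (f : ℕ → Prop) : PForm → Prop
  | .var n => f n
  | .neg φ => ¬ PForm.eval f φ
  | .and φ ψ => PForm.eval f φ ∧ PForm.eval f ψ

/-- Substitution of 𝓛-formulas for the variables of a propositional formula;
the substitution instances of propositional tautologies are the
"propositional tautologies" of 𝓛. -/
def PForm.subst (σ : ℕ → Form) : PForm → Form
  | .var n => σ n
  | .neg φ => .neg (PForm.subst σ φ)
  | .and φ ψ => .and (PForm.subst σ φ) (PForm.subst σ ψ)

/-- The logic L: the smallest set of 𝓛-formulas containing all propositional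
tautologies and the axioms K_S, T_S, 5_S, K_A, T_A, 5_A, ES, Inc, and closed
under modus ponens, necessitation for A, and replacement for S. -/
inductive Thm : Form → Prop where
  | taut (p : PForm) (σ : ℕ → Form) (h : ∀ f : ℕ → Prop, p.eval f) :
      Thm (p.subst σ)
  | KS (φ ψ : Form) :
      Thm ((Form.and (.S φ) (.neg (.S ψ))).imp (.S (.and φ (.neg ψ))))
  | TS (φ : Form) : Thm (φ.imp (.S φ))
  | fiveS (φ : Form) : Thm ((Form.S (.neg (.S φ))).imp (.neg (.S φ)))
  | KA (φ ψ : Form) :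
      Thm ((Form.A (φ.imp ψ)).imp ((Form.A φ).imp (.A ψ)))
  | TA (φ : Form) : Thm ((Form.A φ).imp φ)
  | fiveA (φ : Form) : Thm ((Form.neg (.A φ)).imp (.A (.neg (.A φ))))
  | ES (φ : Form) : Thm ((Form.E φ).iff (.A ((Form.S φ).imp φ)))
  | Inc (φ : Form) : Thm ((Form.A φ).imp (.neg (.S (.neg φ))))
  | mp (φ ψ : Form) : Thm φ → Thm (φ.imp ψ) → Thm ψ
  | necA (φ : Form) : Thm φ → Thm (.A φ)
  | RS (φ ψ : Form) : Thm (φ.iff ψ) → Thm ((Form.S φ).iff (.S ψ))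

namespace ExpModel

variable {X : Type*} (M : ExpModel X)

theorem inter_mem {B C : Set X} (hB : B ∈ M.P) (hC : C ∈ M.P) : B ∩ C ∈ M.P := by
  have h := M.sInter_mem {B, C} (by rintro D (rfl | rfl) <;> assumption)
  rwa [Set.sInter_pair] at h

theorem union_mem {B C : Set X} (hB : B ∈ M.P) (hC : C ∈ M.P) : B ∪ C ∈ M.P := by
  have h := M.compl_mem _ (M.inter_mem (M.compl_mem _ hB) (M.compl_mem _ hC))
  rwa [Set.compl_inter, compl_compl, compl_compl] at h

theorem truthSet_S (φ : Form) :
    truthSet M (.S φ) = ⋂₀ {B | B ∈ M.P ∧ truthSet M φ ⊆ B} := by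
  ext x
  simp [truthSet]

theorem truthSet_S_mem (φ : Form) : truthSet M (.S φ) ∈ M.P := by
  rw [truthSet_S]
  exact M.sInter_mem _ fun _ h => h.1

theorem truthSet_subset_S (φ : Form) : truthSet M φ ⊆ truthSet M (.S φ) :=
  fun _ hx _ _ h => h hx

theorem truthSet_S_subset {φ : Form} {B : Set X} (hB : B ∈ M.P) (h : truthSet M φ ⊆ B) :
    truthSet M (.S φ) ⊆ B :=
  fun _ hx => hx B hB h

theorem sat_imp {x : X} {φ ψ : Form} : Sat M x (φ.imp ψ) ↔ (Sat M x φ → Sat M x ψ) := by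
  simp [Sat, Form.imp, truthSet]

theorem sat_neg {x : X} {φ : Form} : Sat M x (.neg φ) ↔ ¬ Sat M x φ := Iff.rfl

theorem sat_and {x : X} {φ ψ : Form} : Sat M x (.and φ ψ) ↔ Sat M x φ ∧ Sat M x ψ := Iff.rfl

theorem sat_A {x : X} {φ : Form} : Sat M x (.A φ) ↔ ∀ y, Sat M y φ := Iff.rfl

theorem sat_iff {x : X} {φ ψ : Form} : Sat M x (φ.iff ψ) ↔ (Sat M x φ ↔ Sat M x ψ) := by
  rw [Form.iff, sat_and, sat_imp, sat_imp]
  exact iff_def.symm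

theorem sat_subst (x : X) (σ : ℕ → Form) (p : PForm) :
    Sat M x (p.subst σ) ↔ p.eval fun n => Sat M x (σ n) := by
  induction p with
  | var n => rfl
  | neg p ih => exact not_congr ih
  | and p q ihp ihq => exact and_congr ihp ihq

end ExpModel

theorem Thm.sound {φ : Form} (h : Thm φ) {X : Type*} (M : ExpModel X) (x : X) : Sat M x φ := by
  induction h generalizing x with
  | taut p σ h => exact (M.sat_subst x σ p).2 (h _)
  | KS φ ψ =>
    rw [M.sat_imp, M.sat_and, M.sat_neg]
    rintro ⟨hφ, hψ⟩ B hB hsub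
    refine (hφ _ (M.union_mem hB (M.truthSet_S_mem ψ)) fun y hy => ?_).resolve_right hψ
    by_cases hy' : y ∈ truthSet M ψ
    · exact Or.inr (M.truthSet_subset_S ψ hy')
    · exact Or.inl (hsub ⟨hy, hy'⟩)
  | TS φ => exact M.sat_imp.2 fun h => M.truthSet_subset_S φ h
  | fiveS φ =>
    exact M.sat_imp.2 fun h =>
      M.truthSet_S_subset (M.compl_mem _ (M.truthSet_S_mem φ)) subset_rfl h
  | KA φ ψ =>
    simp only [M.sat_imp, M.sat_A]
    exact fun h h' y => h y (h' y)
  | TA φ => exact M.sat_imp.2 fun h => h x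
  | fiveA φ => exact M.sat_imp.2 fun h _ => h
  | ES φ =>
    rw [M.sat_iff, M.sat_A]
    simp only [M.sat_imp]
    constructor
    · exact fun h y hy => M.truthSet_S_subset h subset_rfl hy
    · intro h
      have heq : truthSet M (.S φ) = truthSet M φ :=
        Set.Subset.antisymm (fun y => h y) (M.truthSet_subset_S φ)
      have hS := M.truthSet_S_mem φ
      rwa [heq] at hS
  | Inc φ =>
    rw [M.sat_imp, M.sat_neg]
    intro h hS
    exact (M.truthSet_S_subset (φ := .neg φ) (M.compl_mem _ M.univ_mem)
      (fun y hy => (hy (h y)).elim) hS) trivial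
  | mp φ ψ _ _ ih₁ ih₂ => exact M.sat_imp.1 (ih₂ x) (ih₁ x)
  | necA φ _ ih => exact fun y => ih y
  | RS φ ψ _ ih =>
    have heq : truthSet M φ = truthSet M ψ := Set.ext fun y => M.sat_iff.1 (ih y)
    rw [M.sat_iff, Sat, Sat, M.truthSet_S, M.truthSet_S, heq]

/-- Implication between purely propositional formulas. -/
def PForm.imp (p q : PForm) : PForm := .neg (.and p (.neg q))

/-- A substitution sending the first three variables to the given formulas. -/
def subst₃ (φ ψ χ : Form) : ℕ → Form
  | 0 => φ
  | 1 => ψ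
  | _ => χ

namespace Thm

variable (φ ψ χ : Form)

theorem imp_self : Thm (φ.imp φ) :=
  taut (.imp (.var 0) (.var 0)) (subst₃ φ φ φ) fun f => by simp only [PForm.imp, PForm.eval]; tauto

theorem imp_weaken : Thm (ψ.imp (φ.imp ψ)) :=
  taut (.imp (.var 1) (.imp (.var 0) (.var 1))) (subst₃ φ ψ ψ)
    fun f => by simp only [PForm.imp, PForm.eval]; tauto

theorem imp_distrib : Thm ((φ.imp (ψ.imp χ)).imp ((φ.imp ψ).imp (φ.imp χ))) :=
  taut (.imp (.imp (.var 0) (.imp (.var 1) (.var 2)))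
      (.imp (.imp (.var 0) (.var 1)) (.imp (.var 0) (.var 2)))) (subst₃ φ ψ χ)
    fun f => by simp only [PForm.imp, PForm.eval]; tauto

theorem explosion : Thm (φ.imp ((Form.neg φ).imp χ)) :=
  taut (.imp (.var 0) (.imp (.neg (.var 0)) (.var 2))) (subst₃ φ φ χ)
    fun f => by simp only [PForm.imp, PForm.eval]; tauto

theorem by_cases_imp : Thm ((φ.imp χ).imp (((Form.neg φ).imp χ).imp χ)) :=
  taut (.imp (.imp (.var 0) (.var 2)) (.imp (.imp (.neg (.var 0)) (.var 2)) (.var 2)))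
    (subst₃ φ φ χ) fun f => by simp only [PForm.imp, PForm.eval]; tauto

theorem and_left : Thm ((Form.and φ ψ).imp φ) :=
  taut (.imp (.and (.var 0) (.var 1)) (.var 0)) (subst₃ φ ψ ψ)
    fun f => by simp only [PForm.imp, PForm.eval]; tauto

theorem and_right : Thm ((Form.and φ ψ).imp ψ) :=
  taut (.imp (.and (.var 0) (.var 1)) (.var 1)) (subst₃ φ ψ ψ)
    fun f => by simp only [PForm.imp, PForm.eval]; tauto

theorem and_intro : Thm (φ.imp (ψ.imp (.and φ ψ))) :=
  taut (.imp (.var 0) (.imp (.var 1) (.and (.var 0) (.var 1)))) (subst₃ φ ψ ψ)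
    fun f => by simp only [PForm.imp, PForm.eval]; tauto

end Thm

/-- A set of formulas containing all theorems of L and closed under modus ponens. -/
structure IsTheory (T : Set Form) : Prop where
  thm : ∀ {φ}, Thm φ → φ ∈ T
  mp : ∀ {φ ψ}, φ ∈ T → φ.imp ψ ∈ T → ψ ∈ T

/-- A maximal consistent theory, described by its Boolean behaviour. -/
structure IsWorld (w : Set Form) : Prop where
  thm : ∀ {φ}, Thm φ → φ ∈ w
  neg : ∀ {φ}, Form.neg φ ∈ w ↔ φ ∉ w
  and : ∀ {φ ψ}, Form.and φ ψ ∈ w ↔ φ ∈ w ∧ ψ ∈ w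

theorem isTheory_setOf_thm : IsTheory {φ | Thm φ} :=
  ⟨id, fun h h' => Thm.mp _ _ h h'⟩

theorem IsTheory.setOf_imp {T : Set Form} (hT : IsTheory T) (φ : Form) :
    IsTheory {ψ | φ.imp ψ ∈ T} where
  thm h := hT.mp (hT.thm h) (hT.thm (Thm.imp_weaken _ _))
  mp h h' := hT.mp h (hT.mp h' (hT.thm (Thm.imp_distrib _ _ _)))

theorem IsTheory.sUnion {c : Set (Set Form)} (hc : IsChain (· ⊆ ·) c) (hne : c.Nonempty)
    (h : ∀ T ∈ c, IsTheory T) : IsTheory (⋃₀ c) where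
  thm hφ := by
    obtain ⟨T, hT⟩ := hne
    exact ⟨T, hT, (h T hT).thm hφ⟩
  mp := by
    rintro φ ψ ⟨T, hT, hφ⟩ ⟨U, hU, hφψ⟩
    rcases hc.total hT hU with hTU | hUT
    · exact ⟨U, hU, (h U hU).mp (hTU hφ) hφψ⟩
    · exact ⟨T, hT, (h T hT).mp hφ (hUT hφψ)⟩

/-- Lindenbaum's lemma. -/
theorem IsTheory.exists_isWorld {T : Set Form} (hT : IsTheory T) {χ : Form} (hχ : χ ∉ T) :
    ∃ w, IsWorld w ∧ T ⊆ w ∧ χ ∉ w := by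
  obtain ⟨w, hTw, hw⟩ := zorn_subset_nonempty {U | IsTheory U ∧ χ ∉ U}
    (fun c hcS hc hne => ⟨⋃₀ c,
      ⟨IsTheory.sUnion hc hne fun U hU => (hcS hU).1,
        fun ⟨U, hU, hχU⟩ => (hcS hU).2 hχU⟩,
      fun U hU => Set.subset_sUnion_of_mem hU⟩) T ⟨hT, hχ⟩
  obtain ⟨hwT, hwχ⟩ := hw.prop
  have himp : ∀ {φ}, φ ∉ w → φ.imp χ ∈ w := by
    intro φ hφ
    by_contra hn
    exact hφ (hw.le_of_ge (y := {ψ | φ.imp ψ ∈ w}) ⟨hwT.setOf_imp φ, hn⟩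
      (fun ψ hψ => hwT.mp hψ (hwT.thm (Thm.imp_weaken _ _))) (hwT.thm (Thm.imp_self φ)))
  refine ⟨w, ⟨hwT.thm, fun {φ} => ⟨fun hn hφ => ?_, fun hφ => ?_⟩,
    fun {φ ψ} => ⟨fun h => ⟨?_, ?_⟩, fun h => ?_⟩⟩, hTw, hwχ⟩
  · exact hwχ (hwT.mp hn (hwT.mp hφ (hwT.thm (Thm.explosion _ _))))
  · by_contra hn
    exact hwχ (hwT.mp (himp hn) (hwT.mp (himp hφ) (hwT.thm (Thm.by_cases_imp _ _))))
  · exact hwT.mp h (hwT.thm (Thm.and_left _ _))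
  · exact hwT.mp h (hwT.thm (Thm.and_right _ _))
  · exact hwT.mp h.2 (hwT.mp h.1 (hwT.thm (Thm.and_intro _ _)))

namespace IsWorld

theorem imp {w : Set Form} (hw : IsWorld w) {φ ψ : Form} :
    φ.imp ψ ∈ w ↔ (φ ∈ w → ψ ∈ w) := by
  simp [Form.imp, hw.neg, hw.and]

theorem iff {w : Set Form} (hw : IsWorld w) {φ ψ : Form} :
    φ.iff ψ ∈ w ↔ (φ ∈ w ↔ ψ ∈ w) := by
  rw [Form.iff, hw.and, hw.imp, hw.imp]
  exact iff_def.symm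

theorem mem_of_thm_imp {w : Set Form} (hw : IsWorld w) {φ ψ : Form} (h : Thm (φ.imp ψ)) :
    φ ∈ w → ψ ∈ w :=
  hw.imp.1 (hw.thm h)

end IsWorld

theorem thm_of_forall_isWorld {φ : Form} (h : ∀ w, IsWorld w → φ ∈ w) : Thm φ := by
  by_contra hn
  obtain ⟨w, hw, -, hφ⟩ := isTheory_setOf_thm.exists_isWorld hn
  exact hφ (h w hw)

theorem Thm.S_congr {φ ψ : Form} (h : ∀ w, IsWorld w → (φ ∈ w ↔ ψ ∈ w)) {w : Set Form}
    (hw : IsWorld w) : Form.S φ ∈ w ↔ Form.S ψ ∈ w :=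
  hw.iff.1 (hw.thm (Thm.RS _ _ (thm_of_forall_isWorld fun u hu => hu.iff.2 (h u hu))))

namespace IsWorld

variable {w : Set Form} (hw : IsWorld w)
include hw

theorem A_mono {φ ψ : Form} (h : ∀ u, IsWorld u → φ ∈ u → ψ ∈ u) (hA : Form.A φ ∈ w) :
    Form.A ψ ∈ w :=
  hw.imp.1 (hw.mem_of_thm_imp (Thm.KA φ ψ)
    (hw.thm (Thm.necA _ (thm_of_forall_isWorld fun u hu => hu.imp.2 (h u hu))))) hA

theorem A_neg_A {φ : Form} (h : Form.A φ ∉ w) : Form.A (.neg (.A φ)) ∈ w :=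
  hw.mem_of_thm_imp (Thm.fiveA φ) (hw.neg.2 h)

theorem A_A {φ : Form} (h : Form.A φ ∈ w) : Form.A (.A φ) ∈ w := by
  refine hw.A_mono (φ := .neg (.A (.neg (.A φ)))) (fun u hu hn => ?_) (hw.A_neg_A fun hn => ?_)
  · by_contra hA
    exact hu.neg.1 hn (hu.A_neg_A hA)
  · exact hw.neg.1 (hw.mem_of_thm_imp (Thm.TA _) hn) h

theorem A_iff_of_subset {u : Set Form} (hu : IsWorld u) (h : {ψ | Form.A ψ ∈ w} ⊆ u)
    (ψ : Form) : Form.A ψ ∈ u ↔ Form.A ψ ∈ w := by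
  constructor
  · intro hA
    by_contra hn
    exact hu.neg.1 (h (hw.A_neg_A hn)) hA
  · exact fun hA => h (hw.A_A hA)

theorem exists_not_mem_of_A_not_mem {φ : Form} (h : Form.A φ ∉ w) :
    ∃ u, IsWorld u ∧ (∀ ψ, Form.A ψ ∈ u ↔ Form.A ψ ∈ w) ∧ φ ∉ u := by
  have hT : IsTheory {ψ | Form.A ψ ∈ w} :=
    ⟨fun hψ => hw.thm (Thm.necA _ hψ),
      fun hψ himp => hw.imp.1 (hw.mem_of_thm_imp (Thm.KA _ _) himp) hψ⟩
  obtain ⟨u, hu, hsub, hφ⟩ := hT.exists_isWorld h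
  exact ⟨u, hu, hw.A_iff_of_subset hu hsub, hφ⟩

theorem S_neg_not_mem_of_A {φ : Form} (h : Form.A φ ∈ w) : Form.S (.neg φ) ∉ w :=
  hw.neg.1 (hw.mem_of_thm_imp (Thm.Inc φ) h)

theorem S_of_mem {φ : Form} (h : φ ∈ w) : Form.S φ ∈ w :=
  hw.mem_of_thm_imp (Thm.TS φ) h

theorem S_neg_S {φ : Form} : Form.S (.neg (.S φ)) ∈ w ↔ Form.S φ ∉ w :=
  ⟨fun h => hw.neg.1 (hw.mem_of_thm_imp (Thm.fiveS φ) h), fun h => hw.S_of_mem (hw.neg.2 h)⟩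

theorem S_neg_neg_S {φ : Form} (h : Form.S (.neg (.neg (.S φ))) ∈ w) : Form.S φ ∈ w := by
  have hcongr : Form.S (.neg (.neg (.S φ))) ∈ w ↔ Form.S (.neg (.S (.neg (.S φ)))) ∈ w :=
    Thm.S_congr (fun u hu => by rw [hu.neg, hu.neg, hu.neg, hu.S_neg_S]) hw
  have hn := hw.S_neg_S.1 (hcongr.1 h)
  rw [hw.S_neg_S] at hn
  exact not_not.1 hn

theorem isTheory_S_dual : IsTheory {ψ | Form.S (.neg ψ) ∉ w} where
  thm h := hw.S_neg_not_mem_of_A (hw.thm (Thm.necA _ h))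
  mp {φ ψ} hφ himp hψ := by
    refine himp ?_
    have h : Form.S (.and (.neg ψ) (.neg (.neg φ))) ∈ w :=
      hw.mem_of_thm_imp (Thm.KS _ _) (hw.and.2 ⟨hψ, hw.neg.2 hφ⟩)
    refine (Thm.S_congr (fun u hu => ?_) hw).1 h
    rw [hu.and, hu.neg, hu.neg, hu.neg, hu.neg, hu.imp]
    tauto

theorem exists_mem_of_S_mem {φ : Form} (h : Form.S φ ∈ w) :
    ∃ u, IsWorld u ∧ (∀ ψ, Form.A ψ ∈ u ↔ Form.A ψ ∈ w) ∧
      (∀ ψ, Form.S ψ ∈ u ↔ Form.S ψ ∈ w) ∧ φ ∈ u := by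
  have hφ : Form.neg φ ∉ {ψ | Form.S (.neg ψ) ∉ w} := fun hn =>
    hn ((Thm.S_congr (fun u hu => by rw [hu.neg, hu.neg, not_not]) hw).2 h)
  obtain ⟨u, hu, hsub, hφu⟩ := hw.isTheory_S_dual.exists_isWorld hφ
  refine ⟨u, hu, hw.A_iff_of_subset hu fun ψ hψ => hsub (hw.S_neg_not_mem_of_A hψ),
    fun ψ => ⟨fun hψ => ?_, fun hψ => ?_⟩, ?_⟩
  · by_contra hn
    exact hu.neg.1 (hsub fun h' => hn (hw.S_neg_neg_S h')) hψ
  · exact hsub fun h' => hw.S_neg_S.1 h' hψ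
  · rw [hu.neg] at hφu
    exact not_not.1 hφu

end IsWorld

/-- The worlds that agree with `w` on all formulas `A ψ`. -/
abbrev CanonicalState (w : Set Form) : Type :=
  {u : Set Form // IsWorld u ∧ ∀ ψ, Form.A ψ ∈ u ↔ Form.A ψ ∈ w}

/-- The canonical model: expertise sets are unions of classes of worlds that agree on all
formulas `S ψ`. -/
def canonicalModel.{u} (w : Set Form) : ExpModel (ULift.{u} (CanonicalState w)) where
  P := {B | ∀ x y, (∀ ψ, Form.S ψ ∈ x.down.1 ↔ Form.S ψ ∈ y.down.1) → x ∈ B → y ∈ B}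
  univ_mem _ _ _ _ := trivial
  compl_mem _ hB x y hxy hx hy := hx (hB y x (fun ψ => (hxy ψ).symm) hy)
  sInter_mem _ hQ x y hxy hx B hB := hQ hB x y hxy (hx B hB)
  v p := {x | Form.var p ∈ x.down.1}

theorem mem_truthSet_canonicalModel {w : Set Form} (φ : Form) (x : ULift (CanonicalState w)) :
    x ∈ truthSet (canonicalModel w) φ ↔ φ ∈ x.down.1 := by
  induction φ generalizing x with
  | var p => rfl
  | neg φ ih => exact (not_congr (ih x)).trans x.down.2.1.neg.symm
  | and φ ψ ihφ ihψ => exact (and_congr (ihφ x) (ihψ x)).trans x.down.2.1.and.symm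
  | E φ ih =>
    obtain ⟨⟨x, hx, hxw⟩⟩ := x
    rw [hx.iff.1 (hx.thm (Thm.ES φ))]
    constructor
    · intro hP
      by_contra hn
      obtain ⟨y, hy, hyx, hφ⟩ := hx.exists_not_mem_of_A_not_mem hn
      rw [hy.imp, Classical.not_imp] at hφ
      obtain ⟨z, hz, hzy, hzS, hzφ⟩ := hy.exists_mem_of_S_mem hφ.1
      have hyw ψ := (hyx ψ).trans (hxw ψ)
      exact hφ.2 ((ih ⟨y, hy, hyw⟩).1
        (hP ⟨z, hz, fun ψ => (hzy ψ).trans (hyw ψ)⟩ _ hzS ((ih _).2 hzφ)))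
    · rintro hA ⟨y, hy, hyw⟩ ⟨z, hz, hzw⟩ hyz hyφ
      refine (ih _).2 (hz.imp.1 (hz.mem_of_thm_imp (Thm.TA ((Form.S φ).imp φ)) ?_) ?_)
      · exact (hzw _).2 ((hxw _).1 hA)
      · exact (hyz φ).1 (hy.S_of_mem ((ih _).1 hyφ))
  | S φ ih =>
    obtain ⟨⟨x, hx, hxw⟩⟩ := x
    constructor
    · intro h
      exact h {y | Form.S φ ∈ y.down.1} (fun y z hyz hy => (hyz φ).1 hy)
        fun y hy => y.down.2.1.S_of_mem ((ih y).1 hy)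
    · intro h B hB hsub
      obtain ⟨z, hz, hzx, hzS, hzφ⟩ := hx.exists_mem_of_S_mem h
      exact hB ⟨z, hz, fun ψ => (hzx ψ).trans (hxw ψ)⟩ _ hzS (hsub ((ih _).2 hzφ))
  | A φ ih =>
    obtain ⟨⟨x, hx, hxw⟩⟩ := x
    constructor
    · intro h
      by_contra hn
      obtain ⟨y, hy, hyx, hφ⟩ := hx.exists_not_mem_of_A_not_mem hn
      exact hφ ((ih ⟨y, hy, fun ψ => (hyx ψ).trans (hxw ψ)⟩).1 (h _))
    · rintro hA ⟨y, hy, hyw⟩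
      exact (ih _).2 (hy.mem_of_thm_imp (Thm.TA φ) ((hyw φ).2 ((hxw φ).1 hA)))

/-- The logic L is sound and (weakly) complete with respect to expertise frames:
φ is a theorem of L iff φ is valid. -/
theorem L_sound_complete (φ : Form) : Thm φ ↔ Valid φ := by
  refine ⟨fun h X M x => h.sound M x, fun h => thm_of_forall_isWorld fun w hw => ?_⟩
  exact (mem_truthSet_canonicalModel φ ⟨w, hw, fun _ => Iff.rfl⟩).1 (h _ (canonicalModel w) _)
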